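/- Let k be a perfect field of characteristic p > 0, let R = k[x_1, ..., x_d], and let f ∈ R be a nonzero polynomial. Then the descending chain of ideals I_1(f^(p−1)) ⊇ I_2(f^(p²−1)) ⊇ ... ⊇ I_n(f^(p^n−1)) ⊇ ... stabilizes; that is, there exists N such that I_n(f^(p^n − 1)) = I_N(f^(p^N − 1)) for all n ≥ N. -/

import Mathlib

open MvPolynomial

noncomputable section

variable {k : Type*} [Field k] {d : ℕ}

/-- The divided-power (Hasse) differential operator `D_β` on `k[x_1,…,x_d]`,
determined on monomials by `D_β(x^γ) = (∏ i, choose (γ i) (β i)) x^(γ-β)`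
(which is `0` unless `β ≤ γ`, since then some binomial coefficient vanishes). -/
def Dop (β : Fin d →₀ ℕ) (f : MvPolynomial (Fin d) k) : MvPolynomial (Fin d) k :=
  ∑ γ ∈ f.support, (∏ i, (γ i).choose (β i)) • monomial (γ - β) (coeff γ f)

/-- The component `f_α(x^q)` in the decomposition `f = Σ_{0 ≤ α < q} f_α(x^q) x^α`
of `f` with respect to `x^q` (for `q = p^n`). -/
def Jcomp (q : ℕ) (f : MvPolynomial (Fin d) k) (α : Fin d →₀ ℕ) : MvPolynomial (Fin d) k :=
  ∑ γ ∈ f.support.filter (fun γ => ∀ i, γ i % q = α i), monomial (γ - α) (coeff γ f)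

/-- The ideal `J_n(f)` generated by the components `f_α(x^q)`, `0 ≤ α < q`, where `q = p^n`. -/
def Jideal (q : ℕ) (f : MvPolynomial (Fin d) k) : Ideal (MvPolynomial (Fin d) k) :=
  Ideal.span { g | ∃ α : Fin d →₀ ℕ, (∀ i, α i < q) ∧ g = Jcomp q f α }

/-- The ideal `I_n(f)` generated by the (unique, when they exist) `q`-th roots of the
components `f_α(x^q)`, `0 ≤ α < q`, where `q = p^n`. -/
def Iideal (q : ℕ) (f : MvPolynomial (Fin d) k) : Ideal (MvPolynomial (Fin d) k) :=
  Ideal.span { h | ∃ α : Fin d →₀ ℕ, (∀ i, α i < q) ∧ h ^ q = Jcomp q f α }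

/-- The Frobenius power `I^{[q]}` of an ideal `I`: the ideal generated by `q`-th powers
of elements of `I`. -/
def frobPow (I : Ideal (MvPolynomial (Fin d) k)) (q : ℕ) : Ideal (MvPolynomial (Fin d) k) :=
  Ideal.span ((fun x => x ^ q) '' (I : Set (MvPolynomial (Fin d) k)))

theorem coeff_Jcomp {q : ℕ} (f : MvPolynomial (Fin d) k) {α : Fin d →₀ ℕ}
    (hα : ∀ i, α i < q) (δ : Fin d →₀ ℕ) :
    coeff δ (Jcomp q f α) = if ∀ i, q ∣ δ i then coeff (δ + α) f else 0 := by
  have hsub : ∀ γ : Fin d →₀ ℕ, (∀ i, γ i % q = α i) → γ - α + α = γ := fun γ hγ =>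
    tsub_add_cancel_of_le fun i => by rw [← hγ i]; exact Nat.mod_le _ _
  simp only [Jcomp, coeff_sum, coeff_monomial]
  split_ifs with h
  · by_cases hc : coeff (δ + α) f = 0
    · rw [hc]
      refine Finset.sum_eq_zero fun γ hγ => ?_
      split_ifs with e
      · rw [← hc, ← e, hsub γ (Finset.mem_filter.1 hγ).2]
      · rfl
    · rw [Finset.sum_eq_single (δ + α)]
      · simp
      · intro γ hγ hne
        rw [if_neg]
        rintro rfl
        exact hne (hsub γ (Finset.mem_filter.1 hγ).2).symm
      · intro hn
        refine absurd (Finset.mem_filter.2 ⟨mem_support_iff.2 hc, fun i => ?_⟩) hn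
        obtain ⟨c, hc'⟩ := h i
        simp [hc', Nat.mod_eq_of_lt (hα i)]
  · refine Finset.sum_eq_zero fun γ hγ => ?_
    rw [if_neg]
    rintro rfl
    refine h fun i => ?_
    rw [Finsupp.tsub_apply, ← (Finset.mem_filter.1 hγ).2 i]
    exact Nat.dvd_sub_mod _

theorem Jcomp_add {q : ℕ} (f g : MvPolynomial (Fin d) k) {α : Fin d →₀ ℕ}
    (hα : ∀ i, α i < q) : Jcomp q (f + g) α = Jcomp q f α + Jcomp q g α := by
  ext δ
  simp only [coeff_Jcomp _ hα, coeff_add]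
  split_ifs <;> simp

theorem Jcomp_mul_monomial {q : ℕ} (f : MvPolynomial (Fin d) k) {α : Fin d →₀ ℕ}
    (hα : ∀ i, α i < q) (ε : Fin d →₀ ℕ) (c : k) :
    Jcomp q (f * monomial (q • ε) c) α = Jcomp q f α * monomial (q • ε) c := by
  ext δ
  have hle : (∀ i, q ∣ δ i) → (q • ε ≤ δ + α ↔ q • ε ≤ δ) := by
    refine fun h => ⟨fun hl i => ?_, fun hl => hl.trans le_self_add⟩
    obtain ⟨m, hm⟩ := h i
    have h1 : q * ε i ≤ q * m + α i := by simpa [hm] using hl i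
    have h2 : q * ε i < q * (m + 1) := by rw [mul_add]; have := hα i; omega
    simpa [hm] using Nat.mul_le_mul_left q (Nat.lt_succ_iff.1 (Nat.lt_of_mul_lt_mul_left h2))
  have hdvd : q • ε ≤ δ → ((∀ i, q ∣ (δ - q • ε) i) ↔ ∀ i, q ∣ δ i) := by
    refine fun hl => forall_congr' fun i => ?_
    have := hl i
    rw [Finsupp.tsub_apply, Nat.dvd_sub_iff_left this (by simp)]
  rw [coeff_Jcomp _ hα, coeff_mul_monomial', coeff_mul_monomial', coeff_Jcomp _ hα]
  by_cases h : ∀ i, q ∣ δ i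
  · by_cases hl : q • ε ≤ δ
    · rw [if_pos h, if_pos ((hle h).2 hl), if_pos hl, if_pos ((hdvd hl).2 h),
        tsub_add_eq_add_tsub hl]
    · rw [if_pos h, if_neg (mt (hle h).1 hl), if_neg hl]
  · by_cases hl : q • ε ≤ δ
    · rw [if_neg h, if_pos hl, if_neg (mt (hdvd hl).1 h), zero_mul]
    · rw [if_neg h, if_neg hl]

theorem Jcomp_mul_pow (p : ℕ) [Fact p.Prime] [CharP k p] (n : ℕ)
    (f u : MvPolynomial (Fin d) k) {α : Fin d →₀ ℕ} (hα : ∀ i, α i < p ^ n) :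
    Jcomp (p ^ n) (f * u ^ p ^ n) α = Jcomp (p ^ n) f α * u ^ p ^ n := by
  induction u using MvPolynomial.induction_on' with
  | monomial ε c => rw [monomial_pow, Jcomp_mul_monomial f hα]
  | add u v hu hv => rw [add_pow_char_pow, mul_add, mul_add, Jcomp_add _ _ hα, hu, hv]

theorem exists_pow_eq_Jcomp (p : ℕ) [Fact p.Prime] [CharP k p] [PerfectRing k p] (n : ℕ)
    (f : MvPolynomial (Fin d) k) (α : Fin d →₀ ℕ) :
    ∃ h, h ^ p ^ n = Jcomp (p ^ n) f α := by
  suffices Jcomp (p ^ n) f α ∈ (iterateFrobenius (MvPolynomial (Fin d) k) p n).range from this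
  refine sum_mem fun γ hγ => ?_
  have hmod := (Finset.mem_filter.1 hγ).2
  obtain ⟨c, hc⟩ := (bijective_iterateFrobenius k p n).2 (coeff γ f)
  have hdiv : ∀ i, ∃ m, γ i - α i = p ^ n * m := fun i => by
    rw [← hmod i]; exact Nat.dvd_sub_mod _
  choose m hm using hdiv
  refine ⟨monomial (Finsupp.equivFunOnFinite.symm m) c, ?_⟩
  rw [iterateFrobenius_def, monomial_pow, ← hc, iterateFrobenius_def]
  congr 2
  ext i
  simp [hm]

theorem sum_Jcomp_mul_monomial (q : ℕ) (f : MvPolynomial (Fin d) k) :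
    ∑ α ∈ f.support.image (fun γ => Finsupp.equivFunOnFinite.symm fun i => γ i % q),
      Jcomp q f α * monomial α 1 = f := by
  refine Eq.trans ?_ ((Finset.sum_fiberwise_of_maps_to (fun γ hγ => Finset.mem_image_of_mem
    (fun γ : Fin d →₀ ℕ => Finsupp.equivFunOnFinite.symm fun i => γ i % q) hγ)
    fun γ => monomial γ (coeff γ f)).trans f.as_sum.symm)
  refine Finset.sum_congr rfl fun α _ => ?_
  rw [Jcomp, Finset.sum_mul]
  refine Finset.sum_congr (Finset.filter_congr fun γ _ => by simp [Finsupp.ext_iff]) fun γ hγ => ?_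
  have hmod : ∀ i, γ i % q = α i := by simpa [Finsupp.ext_iff] using (Finset.mem_filter.1 hγ).2
  rw [monomial_mul, mul_one, tsub_add_cancel_of_le]
  exact fun i => by rw [← hmod i]; exact Nat.mod_le _ _

theorem mem_frobPow_Iideal (p : ℕ) [Fact p.Prime] [CharP k p] [PerfectRing k p] (n : ℕ)
    (f : MvPolynomial (Fin d) k) : f ∈ frobPow (Iideal (p ^ n) f) (p ^ n) := by
  suffices h : ∑ α ∈ f.support.image
      (fun γ => Finsupp.equivFunOnFinite.symm fun i => γ i % p ^ n),
      Jcomp (p ^ n) f α * monomial α 1 ∈ frobPow (Iideal (p ^ n) f) (p ^ n) by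
    rwa [sum_Jcomp_mul_monomial] at h
  refine sum_mem fun α hα => Ideal.mul_mem_right _ _ ?_
  obtain ⟨γ, -, rfl⟩ := Finset.mem_image.1 hα
  obtain ⟨h, hh⟩ := exists_pow_eq_Jcomp p n f
    (Finsupp.equivFunOnFinite.symm fun i => γ i % p ^ n)
  rw [← hh]
  exact Ideal.subset_span ⟨h, Ideal.subset_span
    ⟨_, fun i => Nat.mod_lt _ (pow_pos (Fact.out : p.Prime).pos n), hh⟩, rfl⟩

theorem Iideal_le_of_mem_frobPow (p : ℕ) [Fact p.Prime] [CharP k p] [PerfectRing k p] (n : ℕ)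
    {f : MvPolynomial (Fin d) k} {I : Ideal (MvPolynomial (Fin d) k)}
    (hf : f ∈ frobPow I (p ^ n)) : Iideal (p ^ n) f ≤ I := by
  refine Ideal.span_le.2 ?_
  rintro h ⟨α, hα, hh⟩
  have key : ∀ a, ∃ u ∈ I, u ^ p ^ n = Jcomp (p ^ n) (a * f) α := by
    refine Submodule.span_induction
      (p := fun g _ => ∀ a, ∃ u ∈ I, u ^ p ^ n = Jcomp (p ^ n) (a * g) α) ?_ ?_ ?_ ?_ hf
    · rintro _ ⟨v, hv, rfl⟩ a
      obtain ⟨b, hb⟩ := exists_pow_eq_Jcomp p n a α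
      exact ⟨b * v, I.mul_mem_left b hv, by rw [mul_pow, hb, Jcomp_mul_pow p n a v hα]⟩
    · exact fun a => ⟨0, I.zero_mem, by
        rw [zero_pow (pow_ne_zero n (Fact.out : p.Prime).ne_zero)]; simp [Jcomp]⟩
    · intro x y _ _ hx hy a
      obtain ⟨u, hu, hu'⟩ := hx a
      obtain ⟨v, hv, hv'⟩ := hy a
      exact ⟨u + v, I.add_mem hu hv, by rw [add_pow_char_pow, hu', hv', mul_add, Jcomp_add _ _ hα]⟩
    · intro b x _ hx a
      simpa [mul_assoc] using hx (a * b)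
  obtain ⟨u, hu, hu'⟩ := key 1
  rw [one_mul, ← hh] at hu'
  rwa [← iterateFrobenius_inj (MvPolynomial (Fin d) k) p n hu']

theorem pow_mem_frobPow (p : ℕ) [Fact p.Prime] [CharP k p] {q : ℕ}
    {I : Ideal (MvPolynomial (Fin d) k)} {x : MvPolynomial (Fin d) k} (hx : x ∈ frobPow I q) :
    x ^ p ∈ frobPow I (q * p) := by
  have h := Ideal.mem_map_of_mem (frobenius (MvPolynomial (Fin d) k) p) hx
  rw [frobPow, Ideal.map_span, Set.image_image] at h
  simpa only [frobPow, frobenius_def, ← pow_mul] using h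

theorem Iideal_succ_le (p : ℕ) [Fact p.Prime] [CharP k p] [PerfectRing k p]
    (f : MvPolynomial (Fin d) k) (n : ℕ) :
    Iideal (p ^ (n + 1)) (f ^ (p ^ (n + 1) - 1)) ≤ Iideal (p ^ n) (f ^ (p ^ n - 1)) := by
  have hp := (Fact.out : p.Prime).pos
  have hexp : p ^ (n + 1) - 1 = (p ^ n - 1) * p + (p - 1) := by
    have h1 := Nat.le_mul_of_pos_left p (pow_pos hp n)
    rw [pow_succ, Nat.sub_mul]
    omega
  refine Iideal_le_of_mem_frobPow p (n + 1) ?_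
  rw [hexp, pow_succ p n, pow_add, pow_mul]
  exact Ideal.mul_mem_right _ _ (pow_mem_frobPow p (mem_frobPow_Iideal p n _))

theorem totalDegree_Jcomp_le (q : ℕ) (f : MvPolynomial (Fin d) k) (α : Fin d →₀ ℕ) :
    (Jcomp q f α).totalDegree ≤ f.totalDegree := by
  refine totalDegree_finsetSum_le fun γ hγ => (totalDegree_monomial_le _ _).trans ?_
  refine le_trans ?_ (le_totalDegree (Finset.mem_filter.1 hγ).1)
  rw [Finsupp.sum_fintype _ _ fun _ => rfl, Finsupp.sum_fintype _ _ fun _ => rfl]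
  exact Finset.sum_le_sum fun i _ => Nat.sub_le _ _

theorem totalDegree_pow_eq_mul (h : MvPolynomial (Fin d) k) (n : ℕ) :
    (h ^ n).totalDegree = n * h.totalDegree := by
  rcases eq_or_ne h 0 with rfl | h0
  · rcases Nat.eq_zero_or_pos n with rfl | hn <;> simp [*, Nat.ne_of_gt]
  · induction n with
    | zero => simp
    | succ n ih =>
      rw [pow_succ, totalDegree_mul_of_isDomain (pow_ne_zero n h0) h0, ih, Nat.succ_mul]

theorem totalDegree_le_of_pow_eq_Jcomp {q : ℕ} (hq : 0 < q) {f h : MvPolynomial (Fin d) k}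
    {α : Fin d →₀ ℕ} (hh : h ^ q = Jcomp q (f ^ (q - 1)) α) :
    h.totalDegree ≤ f.totalDegree := by
  have h1 : q * h.totalDegree ≤ q * f.totalDegree := by
    rw [← totalDegree_pow_eq_mul, hh]
    exact (totalDegree_Jcomp_le _ _ _).trans ((totalDegree_pow _ _).trans
      (Nat.mul_le_mul_right _ (Nat.sub_le _ _)))
  exact Nat.le_of_mul_le_mul_left h1 hq

/-- the descending chain of ideals `I_n(f^(p^n - 1))` stabilizes. -/
theorem stmt10 (p : ℕ) [Fact p.Prime] (k : Type*) [Field k] [CharP k p] [PerfectRing k p]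
    (d : ℕ) (f : MvPolynomial (Fin d) k) (hf : f ≠ 0) :
    ∃ N : ℕ, 1 ≤ N ∧ ∀ n, N ≤ n →
      Iideal (p ^ n) (f ^ (p ^ n - 1)) = Iideal (p ^ N) (f ^ (p ^ N - 1)) := by
  let J : ℕ → Ideal (MvPolynomial (Fin d) k) := fun n => Iideal (p ^ n) (f ^ (p ^ n - 1))
  have hanti : Antitone J := antitone_nat_of_succ_le (Iideal_succ_le p f)
  let W := restrictTotalDegree (Fin d) k f.totalDegree
  let V : ℕ →o (Submodule k W)ᵒᵈ :=
    { toFun := fun n => OrderDual.toDual (((J n).restrictScalars k).comap W.subtype)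
      monotone' := fun m n hmn x hx => hanti hmn hx }
  obtain ⟨M, hM⟩ := IsArtinian.monotone_stabilizes V
  have hle : ∀ n, M ≤ n → J M ≤ J n := by
    refine fun n hn => Ideal.span_le.2 ?_
    rintro h ⟨α, hα, hh⟩
    have hW : h ∈ W := (mem_restrictTotalDegree _ _ _).2
      (totalDegree_le_of_pow_eq_Jcomp (pow_pos (Fact.out : p.Prime).pos M) hh)
    have hmem : (⟨h, hW⟩ : W) ∈ OrderDual.ofDual (V M) := Ideal.subset_span ⟨α, hα, hh⟩
    rw [hM n hn] at hmem
    exact hmem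
  exact ⟨M + 1, Nat.le_add_left _ _, fun n hn => le_antisymm (hanti hn)
    ((hanti (Nat.le_succ M)).trans (hle n (Nat.le_of_succ_le hn)))⟩
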